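/- arXiv:1807.10710 — 2 statements merged into one kernel-verified Lean document; each statement's English description precedes it below -/
import Mathlib

section
/- For any m₀ ∈ P(𝕋^d) and any ε > 0, there exists a function Φ : P(𝕋^d) → ℝ of class C¹ (in the flat-derivative sense) such that Φ(m₀) = 1, Φ = 0 on the complement of the ball of radius ε around m₀ in the 1-Wasserstein distance, the spatial gradient of the flat derivative satisfies ‖D_mΦ‖_∞ ≤ 10/ε, and D_x D_mΦ is bounded. -/
/- Common framework for "On the long time convergence of potential MFG" (M. Masoero).

We work on the flat torus `𝕋^d`, modeled as `Td d := Fin d → AddCircle 1`.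
Smooth functions on the torus are represented by `ℤ^d`-periodic functions on
`Vd d := Fin d → ℝ`; a function on `Vd d` is transported to the torus through the
canonical (measurable) section `secT : Td d → Vd d`.  Probability measures on the
torus are `PTd d := ProbabilityMeasure (Td d)`, endowed with the 1-Wasserstein
distance `W1` defined through Kantorovich duality.  The Fokker--Planck equations
and their stationary analogues are stated in the sense of distributions, i.e.
against smooth periodic test functions; `σ` is the viscosity parameter
(everywhere `σ = 1` except in the non-convex example). -/

open MeasureTheory Real Set Filter

noncomputable section

abbrev Vd (d : ℕ) : Type := Fin d → ℝ
abbrev Td (d : ℕ) : Type := Fin d → AddCircle (1 : ℝ)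

instance factOneposR : Fact ((0:ℝ) < 1) := ⟨one_pos⟩

/-- The canonical measurable section of the torus, with values in `[0,1)^d`. -/
def secT {d : ℕ} (y : Td d) : Vd d := fun i => ((AddCircle.equivIco 1 0) (y i)).1

/-- The vector of `ℝ^d` associated with an integer vector. -/
def intVec {d : ℕ} (z : Fin d → ℤ) : Vd d := fun i => (z i : ℝ)

/-- Euclidean scalar product on `ℝ^d`. -/
def dotp {d : ℕ} (a b : Vd d) : ℝ := ∑ i, a i * b i

/-- Squared euclidean norm on `ℝ^d`. -/
def sqnorm {d : ℕ} (a : Vd d) : ℝ := ∑ i, (a i)^2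

/-- Spatial gradient. -/
def gradv {d : ℕ} (g : Vd d → ℝ) (x : Vd d) : Vd d := fun i => fderiv ℝ g x (Pi.single i 1)

/-- Second derivative of `g` at `x` in the directions `v, w`. -/
def D2 {d : ℕ} (g : Vd d → ℝ) (x v w : Vd d) : ℝ := fderiv ℝ (fun y => fderiv ℝ g y v) x w

/-- Laplacian. -/
def lapl {d : ℕ} (g : Vd d → ℝ) (x : Vd d) : ℝ := ∑ i, D2 g x (Pi.single i 1) (Pi.single i 1)

/-- Divergence of a vector field. -/
def divv {d : ℕ} (b : Vd d → Vd d) (x : Vd d) : ℝ :=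
  ∑ i, fderiv ℝ (fun y => b y i) x (Pi.single i 1)

/-- Time derivative of a time dependent function. -/
def tderiv {d : ℕ} (u : ℝ → Vd d → ℝ) (t : ℝ) (x : Vd d) : ℝ := deriv (fun s => u s x) t

abbrev PTd (d : ℕ) := ProbabilityMeasure (Td d)

/-- The 1-Wasserstein (Monge--Kantorovich) distance, via Kantorovich duality. -/
def W1 {d : ℕ} (μ ν : PTd d) : ℝ :=
  sSup { r | ∃ φ : Td d → ℝ, LipschitzWith 1 φ ∧
    r = (∫ y, φ y ∂(μ : Measure (Td d))) - ∫ y, φ y ∂(ν : Measure (Td d)) }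

/-- The convex combination `(1-t) μ + t ν`. -/
def lineComb {d : ℕ} (t : ℝ) (μ ν : PTd d) : Measure (Td d) :=
  ENNReal.ofReal (1 - t) • (μ : Measure (Td d)) + ENNReal.ofReal t • (ν : Measure (Td d))

/-- The standing assumptions of the paper: a Hamiltonian `H` (a `ℤ^d`-periodic function of
`(x,p)`), its convex conjugate `Hstar` in the `p` variable, a `C²` coupling function
`Fc` on `P(𝕋^d)` with flat derivative `Fd` (represented by periodic functions on `ℝ^d`),
with the regularity and growth conditions of the paper. -/
structure MFGSetting (d : ℕ) where
  H : Vd d → Vd d → ℝ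
  Hstar : Vd d → Vd d → ℝ
  Fc : PTd d → ℝ
  Fd : Measure (Td d) → Vd d → ℝ
  Cbar : ℝ
  Cbar_pos : 0 < Cbar
  θ : ℝ
  θ_mem : θ ∈ Set.Ioo (0:ℝ) 1
  Cg : ℝ
  Cg_pos : 0 < Cg
  CF : ℝ
  H_smooth : ContDiff ℝ 2 (fun q : Vd d × Vd d => H q.1 q.2)
  H_per : ∀ (x : Vd d) (z : Fin d → ℤ) (p : Vd d), H (x + intVec z) p = H x p
  Dpp_lip : ∃ L : ℝ, 0 ≤ L ∧ ∀ (x p₁ p₂ v w : Vd d),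
    |D2 (fun p => H x p) p₁ v w - D2 (fun p => H x p) p₂ v w| ≤ L * ‖p₁ - p₂‖ * ‖v‖ * ‖w‖
  Dpp_lower : ∀ x p v : Vd d, Cbar⁻¹ * sqnorm v ≤ D2 (fun p' => H x p') p v v
  Dpp_upper : ∀ x p v : Vd d, D2 (fun p' => H x p') p v v ≤ Cbar * sqnorm v
  Dxx_growth : ∀ x p v w : Vd d,
    |D2 (fun x' => H x' p) x v w| ≤ Cg * (1 + ‖p‖) ^ (1 + θ) * ‖v‖ * ‖w‖
  Dxp_growth : ∀ x p v w : Vd d,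
    |fderiv ℝ (fun x' => fderiv ℝ (fun p' => H x' p') p v) x w| ≤ Cg * (1 + ‖p‖) ^ θ * ‖v‖ * ‖w‖
  Hstar_eq : ∀ x q : Vd d, IsLUB (Set.range fun p => dotp q p - H x p) (Hstar x q)
  Fd_per : ∀ (μ : Measure (Td d)) (x : Vd d) (z : Fin d → ℤ), Fd μ (x + intVec z) = Fd μ x
  Fd_smooth : ∀ μ : Measure (Td d), IsProbabilityMeasure μ → ContDiff ℝ 2 (Fd μ)
  Fd_D2_bound : ∀ μ : Measure (Td d), IsProbabilityMeasure μ →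
    ∀ x v w : Vd d, |D2 (Fd μ) x v w| ≤ CF * ‖v‖ * ‖w‖
  flat_deriv : ∀ μ ν : PTd d,
    Fc ν - Fc μ = ∫ t in Set.Icc (0:ℝ) 1,
      ((∫ y, Fd (lineComb t μ ν) (secT y) ∂(ν : Measure (Td d))) -
        ∫ y, Fd (lineComb t μ ν) (secT y) ∂(μ : Measure (Td d)))
  Fd_normalized : ∀ μ : PTd d, (∫ y, Fd (μ : Measure (Td d)) (secT y) ∂(μ : Measure (Td d))) = 0
  Fc_bounded : ∃ M : ℝ, ∀ μ : PTd d, |Fc μ| ≤ M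
  Fd_bounded : ∃ M : ℝ, ∀ (μ : PTd d) (x : Vd d), |Fd (μ : Measure (Td d)) x| ≤ M

/-- Smooth periodic test functions on `[0,∞) × 𝕋^d` (resp. `ℝ × 𝕋^d`). -/
def IsTestFun {d : ℕ} (φ : ℝ → Vd d → ℝ) : Prop :=
  ContDiff ℝ 2 (fun q : ℝ × Vd d => φ q.1 q.2) ∧
  ∀ (t : ℝ) (x : Vd d) (z : Fin d → ℤ), φ t (x + intVec z) = φ t x

/-- The weak (distributional) formulation of the Fokker--Planck equation
`-∂ₜ m + σ Δ m + div(m α) = 0` between times `s₁` and `s₂`. -/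
def FPeq {d : ℕ} (σ : ℝ) (m : ℝ → PTd d) (α : ℝ → Td d → Vd d) (s₁ s₂ : ℝ) : Prop :=
  ∀ φ : ℝ → Vd d → ℝ, IsTestFun φ →
    (∫ y, φ s₂ (secT y) ∂(m s₂ : Measure (Td d))) -
      (∫ y, φ s₁ (secT y) ∂(m s₁ : Measure (Td d))) =
    ∫ s in s₁..s₂, ∫ y, (tderiv φ s (secT y) + σ * lapl (φ s) (secT y)
        - dotp (α s y) (gradv (φ s) (secT y))) ∂(m s : Measure (Td d))

/-- Continuity of a curve of measures with respect to the 1-Wasserstein distance. -/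
def W1ContOn {d : ℕ} (m : ℝ → PTd d) (I : Set ℝ) : Prop :=
  ∀ t ∈ I, ∀ ε > 0, ∃ η > 0, ∀ s ∈ I, |s - t| < η → W1 (m s) (m t) < ε

/-- Continuity of a function on `P(𝕋^d)` with respect to the 1-Wasserstein distance. -/
def W1Continuous {d : ℕ} (χ : PTd d → ℝ) : Prop :=
  ∀ μ : PTd d, ∀ ε > 0, ∃ η > 0, ∀ ν : PTd d, W1 μ ν < η → |χ ν - χ μ| < ε

/-- W1-closed subsets of `P(𝕋^d)`. -/
def IsClosedW1 {d : ℕ} (C : Set (PTd d)) : Prop :=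
  ∀ μ : PTd d, (∀ ε > 0, ∃ ν ∈ C, W1 μ ν < ε) → μ ∈ C

/-- The running cost `∫ H*(x,α(s)) dm(s) + 𝓕(m(s))`. -/
def runCost {d : ℕ} (S : MFGSetting d) (m : ℝ → PTd d) (α : ℝ → Td d → Vd d) (s : ℝ) : ℝ :=
  (∫ y, S.Hstar (secT y) (α s y) ∂(m s : Measure (Td d))) + S.Fc (m s)

/-- Admissible pairs `(m,α)` on `[0,T]` starting from `m₀` (with `α ∈ L²_m`). -/
def AdmOn {d : ℕ} (S : MFGSetting d) (σ : ℝ) (m₀ : PTd d) (T : ℝ)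
    (m : ℝ → PTd d) (α : ℝ → Td d → Vd d) : Prop :=
  m 0 = m₀ ∧ W1ContOn m (Set.Icc 0 T) ∧
  (∀ s₁ s₂ : ℝ, 0 ≤ s₁ → s₁ ≤ s₂ → s₂ ≤ T → FPeq σ m α s₁ s₂) ∧
  Measurable (fun q : ℝ × Td d => α q.1 q.2) ∧
  (∫⁻ s in Set.Ioc (0:ℝ) T, ∫⁻ y, ENNReal.ofReal (sqnorm (α s y)) ∂(m s : Measure (Td d))) < ⊤ ∧
  IntervalIntegrable (runCost S m α) volume 0 T

/-- Admissible pairs `(m,α)` on `[0,T]` starting from `m₀`, with `α` merely in `L¹_m`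
(the class `Π_T` used for problems with prescribed endpoints). -/
def AdmOn1 {d : ℕ} (S : MFGSetting d) (σ : ℝ) (m₀ : PTd d) (T : ℝ)
    (m : ℝ → PTd d) (α : ℝ → Td d → Vd d) : Prop :=
  m 0 = m₀ ∧ W1ContOn m (Set.Icc 0 T) ∧
  (∀ s₁ s₂ : ℝ, 0 ≤ s₁ → s₁ ≤ s₂ → s₂ ≤ T → FPeq σ m α s₁ s₂) ∧
  Measurable (fun q : ℝ × Td d => α q.1 q.2) ∧
  (∫⁻ s in Set.Ioc (0:ℝ) T, ∫⁻ y, ENNReal.ofReal (Real.sqrt (sqnorm (α s y)))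
      ∂(m s : Measure (Td d))) < ⊤ ∧
  IntervalIntegrable (runCost S m α) volume 0 T

/-- The finite horizon cost. -/
def costT {d : ℕ} (S : MFGSetting d) (m : ℝ → PTd d) (α : ℝ → Td d → Vd d) (T : ℝ) : ℝ :=
  ∫ s in (0:ℝ)..T, runCost S m α s

/-- The value `𝒰(T,m₀)` of the finite horizon problem. -/
def Ufun {d : ℕ} (S : MFGSetting d) (σ : ℝ) (T : ℝ) (m₀ : PTd d) : ℝ :=
  sInf { r | ∃ m α, AdmOn S σ m₀ T m α ∧ r = costT S m α T }

/-- Admissible pairs for the infinite horizon `δ`-discounted problem. -/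
def AdmDisc {d : ℕ} (S : MFGSetting d) (σ : ℝ) (δ : ℝ) (m₀ : PTd d)
    (m : ℝ → PTd d) (α : ℝ → Td d → Vd d) : Prop :=
  m 0 = m₀ ∧ W1ContOn m (Set.Ici 0) ∧
  (∀ s₁ s₂ : ℝ, 0 ≤ s₁ → s₁ ≤ s₂ → FPeq σ m α s₁ s₂) ∧
  Measurable (fun q : ℝ × Td d => α q.1 q.2) ∧
  (∫⁻ s in Set.Ioi (0:ℝ), ENNReal.ofReal (Real.exp (-δ * s)) *
      ∫⁻ y, ENNReal.ofReal (sqnorm (α s y)) ∂(m s : Measure (Td d))) < ⊤ ∧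
  Integrable (fun s => Real.exp (-δ * s) * runCost S m α s) (volume.restrict (Set.Ioi 0))

/-- The discounted cost. -/
def costDisc {d : ℕ} (S : MFGSetting d) (δ : ℝ) (m : ℝ → PTd d) (α : ℝ → Td d → Vd d) : ℝ :=
  ∫ s in Set.Ioi (0:ℝ), Real.exp (-δ * s) * runCost S m α s

/-- The value `𝒱_δ(m₀)` of the discounted problem. -/
def Vfun {d : ℕ} (S : MFGSetting d) (σ : ℝ) (δ : ℝ) (m₀ : PTd d) : ℝ :=
  sInf { r | ∃ m α, AdmDisc S σ δ m₀ m α ∧ r = costDisc S δ m α }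

/-- `D_p H (x, p)`. -/
def DpH {d : ℕ} (S : MFGSetting d) (x p : Vd d) : Vd d :=
  fun i => fderiv ℝ (fun p' => S.H x p') p (Pi.single i 1)

/-- `C^{1,2}` regularity on `I × 𝕋^d` of a (periodic) time-dependent function. -/
def Creg12 {d : ℕ} (u : ℝ → Vd d → ℝ) (I : Set ℝ) : Prop :=
  ContinuousOn (fun q : ℝ × Vd d => u q.1 q.2) (I ×ˢ Set.univ) ∧
  (∀ x : Vd d, ∀ t ∈ I, DifferentiableAt ℝ (fun s => u s x) t) ∧
  (∀ t ∈ I, ContDiff ℝ 2 (u t)) ∧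
  (∀ t ∈ I, ∀ (x : Vd d) (z : Fin d → ℤ), u t (x + intVec z) = u t x)

/-- `(u,m)` is a classical solution of the `δ`-discounted MFG system on `[0,∞) × 𝕋^d`:
`-∂ₜ u - Δ u + δ u + H(x,Du) = F(x,m)` and `-∂ₜ m + Δ m + div(m D_pH(x,Du)) = 0`. -/
def SolvesDiscMFG {d : ℕ} (S : MFGSetting d) (δ : ℝ) (u : ℝ → Vd d → ℝ) (m : ℝ → PTd d) : Prop :=
  Creg12 u (Set.Ici 0) ∧
  (∀ t ∈ Set.Ici (0:ℝ), ∀ x : Vd d,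
    - tderiv u t x - lapl (u t) x + δ * u t x + S.H x (gradv (u t) x)
      = S.Fd (m t : Measure (Td d)) x) ∧
  W1ContOn m (Set.Ici 0) ∧
  (∀ s₁ s₂ : ℝ, 0 ≤ s₁ → s₁ ≤ s₂ →
    FPeq 1 m (fun s y => DpH S (secT y) (gradv (u s) (secT y))) s₁ s₂)

/-- Admissible pairs for the stationary (ergodic) problem:
`σ Δ m + div(m α) = 0` in the sense of distributions and `α ∈ L²_m`. -/
def StatAdm {d : ℕ} (σ : ℝ) (m : PTd d) (α : Td d → Vd d) : Prop :=
  Measurable α ∧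
  (∫⁻ y, ENNReal.ofReal (sqnorm (α y)) ∂(m : Measure (Td d))) < ⊤ ∧
  ∀ g : Vd d → ℝ, ContDiff ℝ 2 g → (∀ (x : Vd d) (z : Fin d → ℤ), g (x + intVec z) = g x) →
    (∫ y, (σ * lapl g (secT y) - dotp (α y) (gradv g (secT y))) ∂(m : Measure (Td d))) = 0

/-- `ergInf S σ = -λ̄`, the value of the stationary minimization problem. -/
def ergInf {d : ℕ} (S : MFGSetting d) (σ : ℝ) : ℝ :=
  sInf { r | ∃ m α, StatAdm σ m α ∧
    r = (∫ y, S.Hstar (secT y) (α y) ∂(m : Measure (Td d))) + S.Fc m }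

/-- The set of values over which the dynamic programming principle for a corrector
`χ` takes its infimum. -/
def DPPval {d : ℕ} (S : MFGSetting d) (σ : ℝ) (χ : PTd d → ℝ) (lam t : ℝ) (m₀ : PTd d) :
    Set ℝ :=
  { r | ∃ m α, AdmOn S σ m₀ t m α ∧
      r = (∫ s in (0:ℝ)..t, runCost S m α s) + χ (m t) + lam * t }

/-- `χ` is a corrector function: it is continuous and satisfies the dynamic
programming principle with the critical value `λ`. -/
def IsCorrector {d : ℕ} (S : MFGSetting d) (σ : ℝ) (lam : ℝ) (χ : PTd d → ℝ) : Prop :=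
  W1Continuous χ ∧ ∀ (m₀ : PTd d) (t : ℝ), 0 < t → χ m₀ = sInf (DPPval S σ χ lam t m₀)

/-- `(m,α)` is a calibrated curve (defined on all of `ℝ`). -/
def IsCalibrated {d : ℕ} (S : MFGSetting d) (σ : ℝ) (lam : ℝ)
    (m : ℝ → PTd d) (α : ℝ → Td d → Vd d) : Prop :=
  W1ContOn m Set.univ ∧
  (∀ s₁ s₂ : ℝ, s₁ ≤ s₂ → FPeq σ m α s₁ s₂) ∧
  Measurable (fun q : ℝ × Td d => α q.1 q.2) ∧
  (∀ t₁ t₂ : ℝ, (∫⁻ s in Set.Ioc t₁ t₂,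
      ∫⁻ y, ENNReal.ofReal (sqnorm (α s y)) ∂(m s : Measure (Td d))) < ⊤) ∧
  (∀ t₁ t₂ : ℝ, IntervalIntegrable (runCost S m α) volume t₁ t₂) ∧
  ∃ χ : PTd d → ℝ, IsCorrector S σ lam χ ∧ ∀ t₁ t₂ : ℝ, t₁ < t₂ →
    χ (m t₁) = lam * (t₂ - t₁) + (∫ s in t₁..t₂, runCost S m α s) + χ (m t₂)

/-- The projected Mather set. -/
def MatherSet {d : ℕ} (S : MFGSetting d) (σ : ℝ) (lam : ℝ) : Set (PTd d) :=
  { μ | ∃ m α, IsCalibrated S σ lam m α ∧ m 0 = μ }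

/-- Invariant subsets of the projected Mather set. -/
def IsInvariantMFG {d : ℕ} (S : MFGSetting d) (σ : ℝ) (lam : ℝ) (C : Set (PTd d)) : Prop :=
  ∀ μ ∈ C, ∃ m α, IsCalibrated S σ lam m α ∧ m 0 = μ ∧ ∀ t : ℝ, m t ∈ C

/-- Minimal invariant subsets of the projected Mather set. -/
def IsMinimalInvariant {d : ℕ} (S : MFGSetting d) (σ : ℝ) (lam : ℝ) (N : Set (PTd d)) : Prop :=
  N.Nonempty ∧ N ⊆ MatherSet S σ lam ∧ IsClosedW1 N ∧ IsInvariantMFG S σ lam N ∧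
  ∀ C : Set (PTd d), C ⊆ N → C.Nonempty → IsClosedW1 C → IsInvariantMFG S σ lam C → C = N

/-- `δ 𝒱_δ → -λ` uniformly as `δ → 0⁺`. -/
def IsLimitValueV {d : ℕ} (S : MFGSetting d) (σ : ℝ) (lam : ℝ) : Prop :=
  ∀ ε > 0, ∃ δ₀ > 0, ∀ δ : ℝ, 0 < δ → δ ≤ δ₀ → ∀ μ : PTd d,
    |δ * Vfun S σ δ μ - (-lam)| < ε

/-- `𝒰(T,·)/T → -λ` uniformly as `T → ∞`. -/
def IsLimitValueU {d : ℕ} (S : MFGSetting d) (σ : ℝ) (lam : ℝ) : Prop :=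
  ∀ ε > 0, ∃ T₀ : ℝ, ∀ T : ℝ, T₀ ≤ T → ∀ μ : PTd d,
    |Ufun S σ T μ / T - (-lam)| < ε

/-- A function `Φ` on `P(𝕋^d)` is `C¹` with flat derivative `dΦ` (normalized so that
`∫ dΦ(m,·) dm = 0`, periodic in the space variable and jointly continuous). -/
def IsC1Flat {d : ℕ} (Φ : PTd d → ℝ) (dΦ : Measure (Td d) → Vd d → ℝ) : Prop :=
  (∀ (μ : Measure (Td d)) (x : Vd d) (z : Fin d → ℤ), dΦ μ (x + intVec z) = dΦ μ x) ∧
  (∀ μ ν : PTd d,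
    Φ ν - Φ μ = ∫ t in Set.Icc (0:ℝ) 1,
      ((∫ y, dΦ (lineComb t μ ν) (secT y) ∂(ν : Measure (Td d))) -
        ∫ y, dΦ (lineComb t μ ν) (secT y) ∂(μ : Measure (Td d)))) ∧
  (∀ μ : PTd d, (∫ y, dΦ (μ : Measure (Td d)) (secT y) ∂(μ : Measure (Td d))) = 0) ∧
  (∀ ε > 0, ∀ (μ : PTd d) (x : Vd d), ∃ η > 0, ∀ (ν : PTd d) (x' : Vd d),
    W1 μ ν < η → ‖x' - x‖ < η → |dΦ (ν : Measure (Td d)) x' - dΦ (μ : Measure (Td d)) x| < ε)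


def toT {d : ℕ} (x : Vd d) : Td d := fun i => (x i : AddCircle (1:ℝ))

def IsPer {d : ℕ} (f : Vd d → ℝ) : Prop := ∀ (x : Vd d) (z : Fin d → ℤ), f (x + intVec z) = f x

lemma toT_secT {d : ℕ} (y : Td d) : toT (secT y) = y := by
  funext i
  exact AddCircle.coe_equivIco

lemma toT_add_intVec {d : ℕ} (x : Vd d) (z : Fin d → ℤ) : toT (x + intVec z) = toT x := by
  funext i
  simp only [toT, intVec, Pi.add_apply]
  rw [AddCircle.coe_add]
  have : ((z i : ℝ) : AddCircle (1:ℝ)) = 0 := by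
    rw [AddCircle.coe_eq_zero_iff]
    exact ⟨z i, by simp⟩
  rw [this, add_zero]

lemma toT_lip {d : ℕ} : LipschitzWith 1 (toT (d := d)) := by
  refine LipschitzWith.of_dist_le_mul fun x y => ?_
  rw [NNReal.coe_one, one_mul]
  refine (dist_pi_le_iff dist_nonneg).2 fun i => ?_
  refine le_trans ?_ (dist_le_pi_dist x y i)
  rw [dist_eq_norm, dist_eq_norm]
  simp only [toT]
  rw [← AddCircle.coe_sub]
  exact QuotientAddGroup.norm_mk_le_norm

lemma secT_lip {d : ℕ} {f : Vd d → ℝ} (hp : IsPer f) (hf : LipschitzWith 1 f) :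
    LipschitzWith 1 (fun y : Td d => f (secT y)) := by
  refine LipschitzWith.of_dist_le_mul fun x y => ?_
  set z : Fin d → ℤ := fun i => round (secT x i - secT y i) with hz
  have h1 := hf.dist_le_mul (secT x) (secT y + intVec z)
  rw [hp] at h1
  refine h1.trans ?_
  gcongr
  refine (dist_pi_le_iff dist_nonneg).2 fun i => ?_
  refine le_trans ?_ (dist_le_pi_dist x y i)
  conv_rhs => rw [← toT_secT x, ← toT_secT y]
  rw [dist_eq_norm, dist_eq_norm]
  simp only [toT]
  rw [← AddCircle.coe_sub, UnitAddCircle.norm_eq, Real.norm_eq_abs]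
  simp only [Pi.add_apply, intVec, hz]
  apply le_of_eq
  congr 1
  ring

lemma mollify {d : ℕ} {φ : Td d → ℝ} (hφ : LipschitzWith 1 φ) {δ : ℝ} (hδ : 0 < δ) :
    ∃ f : Vd d → ℝ, ContDiff ℝ 2 f ∧ IsPer f ∧ LipschitzWith 1 f ∧
      ∀ x, |f x - φ (toT x)| ≤ δ := by
  set g : Vd d → ℝ := fun x => φ (toT x) with hg
  have gl : LipschitzWith 1 g := by
    have h := hφ.comp (toT_lip (d := d))
    rw [one_mul] at h
    exact h
  let b : ContDiffBump (0 : Vd d) := ⟨δ/2, δ, by linarith, by linarith⟩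
  have gi : LocallyIntegrable g volume := gl.continuous.locallyIntegrable
  have hce : ∀ x, Integrable (fun t => b.normed volume t * g (x - t)) volume := by
    intro x
    apply Continuous.integrable_of_hasCompactSupport
    · exact b.continuous_normed.mul (gl.continuous.comp (by fun_prop))
    · exact b.hasCompactSupport_normed.mul_right
  set f : Vd d → ℝ := fun x => ∫ t, b.normed volume t * g (x - t) with hf
  have hconv : f = convolution (b.normed volume) g (ContinuousLinearMap.lsmul ℝ ℝ) volume := by
    funext x
    simp [hf, convolution_def]
  refine ⟨f, ?_, ?_, ?_, ?_⟩
  · rw [hconv]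
    exact b.hasCompactSupport_normed.contDiff_convolution_left _ b.contDiff_normed gi
  · intro x z
    simp only [hf, hg]
    congr 1
    funext t
    rw [add_sub_right_comm, toT_add_intVec]
  · refine LipschitzWith.of_dist_le_mul fun x y => ?_
    rw [dist_eq_norm, NNReal.coe_one, one_mul]
    simp only [hf]
    rw [← integral_sub (hce x) (hce y)]
    calc _ ≤ ∫ t, b.normed volume t * dist x y := by
            refine norm_integral_le_of_norm_le (b.integrable_normed.mul_const _) ?_
            refine Eventually.of_forall fun t => ?_
            rw [← mul_sub, norm_mul, Real.norm_of_nonneg (b.nonneg_normed t)]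
            refine mul_le_mul_of_nonneg_left ?_ (b.nonneg_normed t)
            have := gl.dist_le_mul (x - t) (y - t)
            simpa [dist_eq_norm] using this
      _ = dist x y := by
            rw [integral_mul_const, b.integral_normed, one_mul]
  · intro x
    rw [← Real.dist_eq, hconv]
    refine b.dist_normed_convolution_le gl.continuous.aestronglyMeasurable ?_
    intro y hy
    have h := gl.dist_le_mul y x
    rw [NNReal.coe_one, one_mul] at h
    exact h.trans (le_of_lt hy)

lemma net (d : ℕ) {δ : ℝ} (hδ : 0 < δ) :
    ∃ (n : ℕ) (f : Fin (n+1) → Vd d → ℝ), (∀ k, ContDiff ℝ 2 (f k)) ∧ (∀ k, IsPer (f k)) ∧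
      (∀ k, LipschitzWith 1 (f k)) ∧
      ∀ φ : Td d → ℝ, LipschitzWith 1 φ → ∃ k, ∃ c : ℝ, ∀ y, |φ y - c - f k (secT y)| ≤ δ := by
  let D : ℝ := Metric.diam (univ : Set (Td d))
  let A : Set (BoundedContinuousFunction (Td d) ℝ) := {g | LipschitzWith 1 g ∧ g 0 = 0}
  have hA : IsCompact (closure A) := by
    refine BoundedContinuousFunction.arzela_ascoli (Icc (-D) D) isCompact_Icc A ?_ ?_
    · rintro g x ⟨hg, h0⟩
      have h1 := hg.dist_le_mul x 0
      have h2 : dist x 0 ≤ D := Metric.dist_le_diam_of_mem isCompact_univ.isBounded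
        (mem_univ _) (mem_univ _)
      rw [h0, Real.dist_eq, NNReal.coe_one, one_mul, sub_zero] at h1
      exact abs_le.1 (h1.trans h2)
    · refine (LipschitzWith.uniformEquicontinuous _ 1 ?_).equicontinuous
      exact fun g => g.2.1
  have htb : TotallyBounded A := hA.totallyBounded.subset subset_closure
  obtain ⟨t, htA, htf, ht⟩ := Metric.finite_approx_of_totallyBounded htb (δ/2) (by linarith)
  have hmol : ∀ g : BoundedContinuousFunction (Td d) ℝ, ∃ f : Vd d → ℝ,
      g ∈ t → ContDiff ℝ 2 f ∧ IsPer f ∧ LipschitzWith 1 f ∧ ∀ x, |f x - g (toT x)| ≤ δ/2 := by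
    intro g
    by_cases hg : g ∈ t
    · obtain ⟨f, hf⟩ := mollify (htA hg).1 (half_pos hδ)
      exact ⟨f, fun _ => hf⟩
    · exact ⟨0, fun h => absurd h hg⟩
  choose F hF using hmol
  have hex : ∀ φ : Td d → ℝ, LipschitzWith 1 φ →
      ∃ g ∈ t, ∃ c : ℝ, ∀ y, |φ y - c - F g (secT y)| ≤ δ := by
    intro φ hφ
    have hl : LipschitzWith 1 (fun y => φ y - φ 0) := by
      refine LipschitzWith.of_dist_le_mul fun x y => ?_
      simpa [Real.dist_eq] using hφ.dist_le_mul x y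
    let G : BoundedContinuousFunction (Td d) ℝ :=
      BoundedContinuousFunction.mkOfCompact ⟨fun y => φ y - φ 0, hl.continuous⟩
    have hG : G ∈ A := ⟨hl, by simp [G]⟩
    obtain ⟨g, hgt, hg⟩ := mem_iUnion₂.1 (ht hG)
    refine ⟨g, hgt, φ 0, fun y => ?_⟩
    have h1 : dist (G y) (g y) ≤ δ/2 :=
      (BoundedContinuousFunction.dist_coe_le_dist y).trans (le_of_lt hg)
    have h2 := (hF g hgt).2.2.2 (secT y)
    rw [toT_secT] at h2
    have h3 : G y = φ y - φ 0 := rfl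
    rw [h3, Real.dist_eq] at h1
    rw [abs_le] at *
    constructor <;> linarith [h1.1, h1.2, h2.1, h2.2]
  have hne : t.Nonempty := by
    obtain ⟨g, hg, -⟩ := hex (fun _ => 0) (LipschitzWith.const' 0)
    exact ⟨g, hg⟩
  have : Fintype t := htf.fintype
  have : Nonempty t := hne.to_subtype
  obtain ⟨n, hn⟩ := Nat.exists_eq_succ_of_ne_zero (Fintype.card_ne_zero (α := t))
  let e : Fin (n+1) ≃ t := (finCongr hn.symm).trans (Fintype.equivFin t).symm
  refine ⟨n, fun k => F (e k), fun k => (hF _ (e k).2).1, fun k => (hF _ (e k).2).2.1,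
    fun k => (hF _ (e k).2).2.2.1, fun φ hφ => ?_⟩
  obtain ⟨g, hgt, c, hc⟩ := hex φ hφ
  refine ⟨e.symm ⟨g, hgt⟩, c, ?_⟩
  simpa using hc

lemma lip_int {d : ℕ} {φ : Td d → ℝ} (hφ : LipschitzWith 1 φ) (μ : Measure (Td d))
    [IsFiniteMeasure μ] : Integrable φ μ :=
  (BoundedContinuousFunction.mkOfCompact ⟨φ, hφ.continuous⟩).integrable μ

lemma W1_bdd {d : ℕ} (μ ν : PTd d) : BddAbove { r | ∃ φ : Td d → ℝ, LipschitzWith 1 φ ∧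
    r = (∫ y, φ y ∂(μ : Measure (Td d))) - ∫ y, φ y ∂(ν : Measure (Td d)) } := by
  let D : ℝ := Metric.diam (univ : Set (Td d))
  refine ⟨2 * D, ?_⟩
  rintro r ⟨φ, hφ, rfl⟩
  have hb : ∀ y, |φ y - φ 0| ≤ D := by
    intro y
    have h1 := hφ.dist_le_mul y 0
    have h2 : dist y 0 ≤ D := Metric.dist_le_diam_of_mem isCompact_univ.isBounded
        (mem_univ _) (mem_univ _)
    rw [Real.dist_eq, NNReal.coe_one, one_mul] at h1
    exact h1.trans h2
  have key : ∀ m : PTd d, |(∫ y, φ y ∂(m : Measure (Td d))) - φ 0| ≤ D := by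
    intro m
    have h : (∫ y, φ y ∂(m : Measure (Td d))) - φ 0 = ∫ y, (φ y - φ 0) ∂(m : Measure (Td d)) := by
      rw [integral_sub (lip_int hφ _) (integrable_const _)]
      simp
    rw [h]
    have := norm_integral_le_of_norm_le_const (μ := (m : Measure (Td d)))
      (f := fun y => φ y - φ 0) (C := D) (Eventually.of_forall hb)
    simpa using this
  have h1 := abs_le.1 (key μ)
  have h2 := abs_le.1 (key ν)
  linarith [h1.1, h1.2, h2.1, h2.2]

lemma W1_ge {d : ℕ} (μ ν : PTd d) {φ : Td d → ℝ} (hφ : LipschitzWith 1 φ) :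
    |(∫ y, φ y ∂(ν : Measure (Td d))) - ∫ y, φ y ∂(μ : Measure (Td d))| ≤ W1 μ ν := by
  rw [abs_le]
  constructor
  · have := le_csSup (W1_bdd μ ν) ⟨φ, hφ, rfl⟩
    change _ ≤ W1 μ ν at this
    linarith
  · have hn : LipschitzWith 1 (fun y => - φ y) := hφ.neg
    have := le_csSup (W1_bdd μ ν) ⟨_, hn, rfl⟩
    change _ ≤ W1 μ ν at this
    rw [integral_neg, integral_neg] at this
    linarith

lemma W1_le {d : ℕ} (μ ν : PTd d) {δ M : ℝ} {n : ℕ} {f : Fin (n+1) → Vd d → ℝ}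
    (hfp : ∀ k, IsPer (f k)) (hfl : ∀ k, LipschitzWith 1 (f k))
    (hnet : ∀ φ : Td d → ℝ, LipschitzWith 1 φ → ∃ k, ∃ c : ℝ, ∀ y, |φ y - c - f k (secT y)| ≤ δ)
    (hM : ∀ k, (∫ y, f k (secT y) ∂(μ : Measure (Td d))) - ∫ y, f k (secT y) ∂(ν : Measure (Td d))
      ≤ M) : W1 μ ν ≤ M + 2 * δ := by
  refine csSup_le ⟨_, fun _ => 0, LipschitzWith.const' 0, rfl⟩ ?_
  rintro r ⟨φ, hφ, rfl⟩
  obtain ⟨k, c, hc⟩ := hnet φ hφ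
  have key : ∀ m : PTd d, |(∫ y, φ y ∂(m : Measure (Td d))) - c
      - ∫ y, f k (secT y) ∂(m : Measure (Td d))| ≤ δ := by
    intro m
    have h : (∫ y, φ y ∂(m : Measure (Td d))) - c - ∫ y, f k (secT y) ∂(m : Measure (Td d))
        = ∫ y, (φ y - c - f k (secT y)) ∂(m : Measure (Td d)) := by
      have h0 : Integrable (fun y => φ y - c) (m : Measure (Td d)) :=
        (lip_int hφ _).sub (integrable_const _)
      rw [integral_sub h0
        (lip_int (secT_lip (hfp k) (hfl k)) _), integral_sub (lip_int hφ _) (integrable_const _)]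
      simp
    rw [h]
    have := norm_integral_le_of_norm_le_const (μ := (m : Measure (Td d)))
      (f := fun y => φ y - c - f k (secT y)) (C := δ) (Eventually.of_forall hc)
    simpa using this
  have h1 := abs_le.1 (key μ)
  have h2 := abs_le.1 (key ν)
  linarith [h1.1, h1.2, h2.1, h2.2, hM k]

lemma grad_le {d : ℕ} {g : Vd d → ℝ} {K : ℝ} (hK : 0 ≤ K)
    (hg : ∀ x y, |g x - g y| ≤ K * ‖x - y‖) (x : Vd d) :
    Real.sqrt (sqnorm (gradv g x)) ≤ K := by
  have hl : LipschitzWith ⟨K, hK⟩ g := LipschitzWith.of_dist_le_mul fun x y => by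
    rw [Real.dist_eq, dist_eq_norm]; exact hg x y
  have hn : ‖fderiv ℝ g x‖ ≤ K := norm_fderiv_le_of_lipschitz ℝ hl
  set L := fderiv ℝ g x with hL
  have hsum : ∑ i, |gradv g x i| ≤ K := by
    let v : Vd d := fun i => SignType.sign (gradv g x i)
    have hv : ‖v‖ ≤ 1 := by
      refine (pi_norm_le_iff_of_nonneg zero_le_one).2 fun i => ?_
      simp only [v]
      rcases SignType.sign (gradv g x i) with _ | _ | _ <;> simp
    have h1 : L v = ∑ i, |gradv g x i| := by
      rw [pi_eq_sum_univ' v, map_sum]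
      refine Finset.sum_congr rfl fun i _ => ?_
      rw [map_smul, smul_eq_mul]
      have : gradv g x i = L (Pi.single i 1) := rfl
      have h2 : (fun j => if i = j then (1:ℝ) else 0) = Pi.single i 1 := by
        funext j; simp [Pi.single_apply, eq_comm]
      rw [← this]; exact sign_mul_self _
    calc _ = L v := h1.symm
      _ ≤ ‖L v‖ := le_abs_self _
      _ ≤ ‖L‖ * ‖v‖ := L.le_opNorm v
      _ ≤ K * 1 := by gcongr
      _ = K := mul_one K
  rw [Real.sqrt_le_iff]
  refine ⟨hK, ?_⟩
  calc sqnorm (gradv g x) = ∑ i, |gradv g x i|^2 := by simp [sqnorm]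
    _ ≤ (∑ i, |gradv g x i|)^2 := Finset.sum_sq_le_sq_sum_of_nonneg fun i _ => abs_nonneg _
    _ ≤ K^2 := by
      gcongr

lemma D2_eq {d : ℕ} {g : Vd d → ℝ} (hg : ContDiff ℝ 2 g) (x v w : Vd d) :
    D2 g x v w = fderiv ℝ (fderiv ℝ g) x w v := by
  have h : DifferentiableAt ℝ (fderiv ℝ g) x :=
    ((hg.fderiv_right (m := 1) (by norm_num)).differentiable (by norm_num)) x
  unfold D2
  rw [fderiv_clm_apply h (differentiableAt_const v)]
  simp

lemma D2_bdd {d : ℕ} {g : Vd d → ℝ} (hg : ContDiff ℝ 2 g) (hp : IsPer g) :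
    ∃ C : ℝ, 0 ≤ C ∧ ∀ x v w : Vd d, |D2 g x v w| ≤ C * ‖v‖ * ‖w‖ := by
  have h1 : ContDiff ℝ 1 (fderiv ℝ g) := hg.fderiv_right (m := 1) (by norm_num)
  have hc : Continuous (fderiv ℝ (fderiv ℝ g)) := h1.continuous_fderiv (by norm_num)
  have hper : ∀ x (z : Fin d → ℤ),
      fderiv ℝ (fderiv ℝ g) (x + intVec z) = fderiv ℝ (fderiv ℝ g) x := by
    intro x z
    rw [← fderiv_comp_add_right]
    congr 1
    funext y
    rw [← fderiv_comp_add_right]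
    congr 1
    funext y'
    exact hp y' z
  obtain ⟨C, hC⟩ := (isCompact_Icc (a := (0 : Vd d)) (b := 1)).exists_bound_of_continuousOn
    (f := fderiv ℝ (fderiv ℝ g)) (by exact hc.continuousOn)
  have hall : ∀ x, ‖fderiv ℝ (fderiv ℝ g) x‖ ≤ C := by
    intro x
    rw [← hper x (fun i => - ⌊x i⌋)]
    apply hC
    constructor
    · intro i
      simp only [intVec, Pi.add_apply, Pi.zero_apply]
      push_cast
      linarith [Int.floor_le (x i)]
    · intro i
      simp only [intVec, Pi.add_apply, Pi.one_apply]
      push_cast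
      linarith [Int.lt_floor_add_one (x i)]
  refine ⟨C, le_trans (by positivity) (hall 0), fun x v w => ?_⟩
  rw [D2_eq hg, ← Real.norm_eq_abs]
  calc _ ≤ ‖fderiv ℝ (fderiv ℝ g) x‖ * ‖w‖ * ‖v‖ := ContinuousLinearMap.le_opNorm₂ _ _ _
    _ ≤ C * ‖w‖ * ‖v‖ := by gcongr; exact hall x
    _ = _ := by ring

def qf (x : ℝ) : ℝ := (max 0 x)^2

lemma qf_deriv (x : ℝ) : HasDerivAt qf (2 * max 0 x) x := by
  rcases lt_trichotomy x 0 with h | h | h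
  · have : qf =ᶠ[nhds x] fun _ => 0 := by
      filter_upwards [Iio_mem_nhds h] with y hy
      simp [qf, max_eq_left (le_of_lt (show y < 0 from hy))]
    rw [max_eq_left h.le, mul_zero]
    exact (hasDerivAt_const x (0:ℝ)).congr_of_eventuallyEq this
  · subst h
    rw [max_self, mul_zero, hasDerivAt_iff_isLittleO_nhds_zero]
    have h1 : (fun h : ℝ => qf (0 + h) - qf 0 - h • (0:ℝ)) =O[nhds 0] fun h : ℝ => h^2 := by
      refine Asymptotics.IsBigO.of_bound 1 (Eventually.of_forall fun h => ?_)
      simp only [qf, zero_add, max_self, smul_zero, sub_zero, Real.norm_eq_abs, one_mul]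
      rw [zero_pow two_ne_zero, sub_zero, abs_of_nonneg (sq_nonneg _), abs_of_nonneg (sq_nonneg _)]
      rcases le_total 0 h with h' | h'
      · simp [max_eq_right h']
      · simp [max_eq_left h']; positivity
    refine h1.trans_isLittleO ?_
    simpa using (Asymptotics.isLittleO_pow_id (𝕜 := ℝ) (n := 2) (by norm_num))
  · have : qf =ᶠ[nhds x] fun y => y^2 := by
      filter_upwards [Ioi_mem_nhds h] with y hy
      simp [qf, max_eq_right (le_of_lt (show 0 < y from hy))]
    rw [max_eq_right h.le]
    have h2 := (hasDerivAt_pow 2 x).congr_of_eventuallyEq this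
    simpa using h2

lemma finite_dim (n : ℕ) {ε : ℝ} (hε : 0 < ε) :
    ∃ (G : (Fin (n+1) → ℝ) → ℝ) (P : (Fin (n+1) → ℝ) → Fin (n+1) → ℝ),
      Continuous P ∧
      (∀ a b : Fin (n+1) → ℝ, ∀ t : ℝ, HasDerivAt (fun t : ℝ => G (a + t • b))
        (∑ k, P (a + t • b) k * b k) t) ∧
      (∀ s, ∑ k, |P s k| ≤ 10 / ε) ∧ G 0 = 1 ∧ (∀ s, (∃ k, ε / 2 ≤ s k) → G s = 0) := by
  have hlN : 0 ≤ Real.log ((n:ℝ)+1) := Real.log_nonneg (by linarith [Nat.cast_nonneg (α := ℝ) n])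
  set β : ℝ := 4 * Real.log ((n:ℝ)+1) / ε + 1 with hβ
  have hβ0 : 0 < β := by positivity
  have hβ1 : Real.log ((n:ℝ)+1) ≤ β * (ε / 4) := by
    rw [hβ]; field_simp; nlinarith
  let E : (Fin (n+1) → ℝ) → ℝ := fun s => ∑ k, Real.exp (β * s k)
  have hE : ∀ s, 0 < E s := fun s => Finset.sum_pos (fun k _ => Real.exp_pos _) Finset.univ_nonempty
  have hEc : Continuous E := by simp only [E]; fun_prop
  let L : (Fin (n+1) → ℝ) → ℝ := fun s => (Real.log (E s) - Real.log ((n:ℝ)+1)) / β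
  have hLc : Continuous L := (((hEc.log fun s => (hE s).ne').sub continuous_const).div_const _)
  let ψ : ℝ → ℝ := fun r => qf (1 - qf (4 / ε * r))
  let ψ' : ℝ → ℝ := fun r =>
    2 * max 0 (1 - qf (4 / ε * r)) * (-(2 * max 0 (4 / ε * r) * (4 / ε)))
  have hqc : Continuous qf := by unfold qf; fun_prop
  have hψc : Continuous ψ' := by simp only [ψ']; fun_prop
  have hψ : ∀ r, HasDerivAt ψ (ψ' r) r := by
    intro r
    have h1 : HasDerivAt (fun r : ℝ => 4 / ε * r) (4 / ε) r := by
      simpa using (hasDerivAt_id r).const_mul (4 / ε)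
    have h2 := ((qf_deriv (4 / ε * r)).comp r h1).const_sub 1
    exact (qf_deriv (1 - qf (4 / ε * r))).comp r h2
  have hψb : ∀ r, |ψ' r| ≤ 10 / ε := by
    intro r
    simp only [ψ', qf]
    set a := max 0 (4 / ε * r) with ha
    have ha0 : 0 ≤ a := le_max_left _ _
    have hm0 : 0 ≤ max 0 (1 - a^2) := le_max_left _ _
    rw [mul_neg, abs_neg, abs_of_nonneg (by positivity)]
    have h : 2 * max 0 (1 - a^2) * (2 * a) ≤ 5/2 := by
      rcases le_total 0 (1 - a^2) with h | h
      · rw [max_eq_right h]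
        nlinarith [sq_nonneg (a - 1/2), mul_nonneg ha0 (sq_nonneg (a-1/2))]
      · rw [max_eq_left h]; norm_num
    calc 2 * max 0 (1 - a^2) * (2 * a * (4 / ε)) = (2 * max 0 (1 - a^2) * (2 * a)) * (4 / ε) := by
          ring
      _ ≤ 5/2 * (4 / ε) := by gcongr
      _ = 10 / ε := by ring
  refine ⟨fun s => ψ (L s), fun s k => ψ' (L s) * (Real.exp (β * s k) / E s), ?_, ?_, ?_, ?_, ?_⟩
  · refine continuous_pi fun k => ?_
    refine (hψc.comp hLc).mul (Continuous.div (by fun_prop) hEc fun s => (hE s).ne')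
  · intro a b t
    have h1 : HasDerivAt (fun t : ℝ => E (a + t • b))
        (∑ k, Real.exp (β * (a + t • b) k) * (β * b k)) t := by
      simp only [E]
      refine HasDerivAt.fun_sum fun k _ => ?_
      refine HasDerivAt.exp ?_
      simp only [Pi.add_apply, Pi.smul_apply, smul_eq_mul]
      have := (((hasDerivAt_id t).mul_const (b k)).const_add (a k)).const_mul β
      simpa using this
    have h2 := ((h1.log (hE _).ne').sub_const (Real.log ((n:ℝ)+1))).div_const β
    have h3 := (hψ (L (a + t • b))).comp t h2
    convert! h3 using 1
    rw [Finset.sum_div, Finset.sum_div, Finset.mul_sum]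
    refine Finset.sum_congr rfl fun k _ => ?_
    have := (hE (a + t • b)).ne'
    field_simp
  · intro s
    simp only [abs_mul]
    rw [← Finset.mul_sum]
    have : ∑ k, |Real.exp (β * s k) / E s| = 1 := by
      have h : ∀ k, |Real.exp (β * s k) / E s| = Real.exp (β * s k) / E s := fun k =>
        abs_of_nonneg (div_nonneg (Real.exp_pos _).le (hE s).le)
      simp only [h]
      rw [← Finset.sum_div]
      exact div_self (hE s).ne'
    rw [this, mul_one]
    exact hψb _
  · simp [ψ, L, E, qf]
  · rintro s ⟨k, hk⟩
    have h1 : Real.exp (β * s k) ≤ E s :=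
      Finset.single_le_sum (f := fun k => Real.exp (β * s k)) (fun k _ => (Real.exp_pos _).le)
        (Finset.mem_univ k)
    have h2 : β * s k ≤ Real.log (E s) := (Real.le_log_iff_exp_le (hE s)).2 h1
    have h3 : ε / 4 ≤ L s := by
      simp only [L]
      rw [le_div_iff₀ hβ0]
      nlinarith
    have h4 : 1 ≤ 4 / ε * L s := by
      calc 1 = 4 / ε * (ε / 4) := by field_simp
        _ ≤ _ := by gcongr
    have h5 : max 0 (4 / ε * L s) = 4 / ε * L s := max_eq_right (by linarith)
    simp only [ψ]
    have h6 : 1 - qf (4 / ε * L s) ≤ 0 := by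
      unfold qf; rw [h5]; nlinarith
    rw [qf, max_eq_left h6]
    norm_num

/-- Lemma 4.2 of the paper.  For any `m₀ ∈ P(𝕋^d)` and `ε > 0` there
is a `C¹` function `Φ` on `P(𝕋^d)` (with flat derivative `dΦ`) such that `Φ(m₀) = 1`,
`Φ = 0` outside the `ε`-ball around `m₀`, `‖D_mΦ‖_∞ ≤ 10/ε` and `D_x D_mΦ` is bounded. -/
theorem bump_function_exists (d : ℕ) (m₀ : PTd d) (ε : ℝ) (hε : 0 < ε) :
    ∃ (Φ : PTd d → ℝ) (dΦ : Measure (Td d) → Vd d → ℝ),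
      IsC1Flat Φ dΦ ∧
      (∀ μ : Measure (Td d), IsProbabilityMeasure μ → ContDiff ℝ 2 (dΦ μ)) ∧
      Φ m₀ = 1 ∧
      (∀ μ : PTd d, ε ≤ W1 m₀ μ → Φ μ = 0) ∧
      (∀ μ : Measure (Td d), IsProbabilityMeasure μ →
        ∀ x : Vd d, Real.sqrt (sqnorm (gradv (dΦ μ) x)) ≤ 10 / ε) ∧
      (∃ C : ℝ, ∀ μ : Measure (Td d), IsProbabilityMeasure μ →
        ∀ x v w : Vd d, |D2 (dΦ μ) x v w| ≤ C * ‖v‖ * ‖w‖) := by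
  obtain ⟨n, f, hfc, hfp, hfl, hnet⟩ := net d (δ := ε / 4) (by linarith)
  obtain ⟨G, P, hPc, hGd, hPb, hG0, hGv⟩ := finite_dim n hε
  let I : Measure (Td d) → Fin (n+1) → ℝ := fun m k => ∫ y, f k (secT y) ∂m
  let a₀ := I (m₀ : Measure (Td d))
  have hfint : ∀ k (m : Measure (Td d)) [IsFiniteMeasure m], Integrable (fun y => f k (secT y)) m :=
    fun k m _ => lip_int (secT_lip (hfp k) (hfl k)) m
  let H : (Fin (n+1) → ℝ) → Vd d → ℝ := fun u x => ∑ k, (-P (a₀ - u) k) * (f k x - u k)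
  have hHd : ∀ u, ContDiff ℝ 2 (H u) := by
    intro u
    simp only [H]
    refine ContDiff.sum fun k _ => contDiff_const.mul ((hfc k).sub contDiff_const)
  have hHint : ∀ u (m : PTd d), ∫ y, H u (secT y) ∂(m : Measure (Td d))
      = ∑ k, (-P (a₀ - u) k) * (I m k - u k) := by
    intro u m
    simp only [H]
    have h0 : ∀ k ∈ (Finset.univ : Finset (Fin (n+1))),
        Integrable (fun y => (-P (a₀ - u) k) * (f k (secT y) - u k)) (m : Measure (Td d)) :=
      fun k _ => ((hfint k _).sub (integrable_const _)).const_mul _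
    rw [integral_finsetSum _ h0]
    refine Finset.sum_congr rfl fun k _ => ?_
    rw [integral_const_mul, integral_sub (hfint k _) (integrable_const _)]
    simp [I]
  choose C hC0 hC using fun k => D2_bdd (hfc k) (hfp k)
  have hK : 0 ≤ 10 / ε := by positivity
  refine ⟨fun μ => G (a₀ - I μ), fun μ x => H (I μ) x, ⟨?_, ?_, ?_, ?_⟩, fun μ _ => hHd _, ?_, ?_, ?_, ?_⟩
  · intro μ x z
    simp only [H]
    refine Finset.sum_congr rfl fun k _ => ?_
    rw [hfp k]
  · intro μ ν
    have hline : ∀ t ∈ Icc (0:ℝ) 1, a₀ - I (lineComb t μ ν)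
        = (a₀ - I μ) + t • (I (μ : Measure (Td d)) - I ν) := by
      intro t ht
      funext k
      have : I (lineComb t μ ν) k = (1 - t) * I μ k + t * I ν k := by
        simp only [I, lineComb]
        rw [integral_add_measure ((hfint k _).smul_measure ENNReal.ofReal_ne_top)
          ((hfint k _).smul_measure ENNReal.ofReal_ne_top), integral_smul_measure,
          integral_smul_measure, ENNReal.toReal_ofReal (by linarith [ht.2]),
          ENNReal.toReal_ofReal ht.1]
        simp
      simp only [Pi.sub_apply, Pi.add_apply, Pi.smul_apply, smul_eq_mul, this]
      ring
    have hcont : Continuous fun t : ℝ => ∑ k,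
        P ((a₀ - I μ) + t • (I (μ : Measure (Td d)) - I ν)) k
          * (I (μ : Measure (Td d)) - I ν) k := by
      refine continuous_finsetSum _ fun k _ => Continuous.mul ?_ continuous_const
      exact (continuous_apply k).comp (hPc.comp (by fun_prop))
    have hftc := intervalIntegral.integral_eq_sub_of_hasDerivAt (a := 0) (b := 1)
      (fun t _ => hGd (a₀ - I μ) (I (μ : Measure (Td d)) - I ν) t) (hcont.intervalIntegrable _ _)
    have e1 : (a₀ - I μ) + (1:ℝ) • (I (μ : Measure (Td d)) - I ν) = a₀ - I ν := by
      rw [one_smul]; abel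
    have e0 : (a₀ - I μ) + (0:ℝ) • (I (μ : Measure (Td d)) - I ν) = a₀ - I μ := by
      rw [zero_smul, add_zero]
    rw [e1, e0, intervalIntegral.integral_of_le zero_le_one, ← integral_Icc_eq_integral_Ioc] at hftc
    rw [← hftc]
    refine setIntegral_congr_fun measurableSet_Icc fun t ht => ?_
    simp only
    rw [hHint, hHint, ← Finset.sum_sub_distrib, hline t ht]
    refine Finset.sum_congr rfl fun k _ => ?_
    simp only [Pi.sub_apply]
    ring
  · intro μ
    simp only
    rw [hHint]
    simp
  · intro e he μ x
    have hHc : Continuous fun p : (Fin (n+1) → ℝ) × Vd d => H p.1 p.2 := by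
      simp only [H]
      refine continuous_finsetSum _ fun k _ => Continuous.mul ?_ ?_
      · exact ((continuous_apply k).comp (hPc.comp (by fun_prop))).neg
      · exact ((hfc k).continuous.comp continuous_snd).sub (by fun_prop)
    obtain ⟨η, hη, h⟩ := Metric.continuous_iff.1 hHc (I μ, x) e he
    refine ⟨η, hη, fun ν x' hW hx => ?_⟩
    have := h (I ν, x') ?_
    · simpa [Real.dist_eq] using this
    · rw [Prod.dist_eq]
      refine max_lt ?_ (by rwa [dist_eq_norm])
      refine (dist_pi_lt_iff hη).2 fun k => ?_
      rw [Real.dist_eq]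
      exact (W1_ge μ ν (secT_lip (hfp k) (hfl k))).trans_lt hW
  · simp only [a₀, sub_self, hG0]
  · intro μ hμ
    apply hGv
    by_contra! hcon
    obtain ⟨k₀, -, hk₀⟩ := Finset.exists_max_image Finset.univ (fun k => (a₀ - I μ) k)
      Finset.univ_nonempty
    have := W1_le m₀ μ (M := (a₀ - I μ) k₀) hfp hfl hnet (fun k => hk₀ k (Finset.mem_univ k))
    linarith [hcon k₀]
  · intro μ _ x
    refine grad_le hK (fun x y => ?_) x
    simp only [H]
    rw [← Finset.sum_sub_distrib]
    calc _ ≤ ∑ k, |P (a₀ - I μ) k| * ‖x - y‖ := by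
          refine (Finset.abs_sum_le_sum_abs _ _).trans (Finset.sum_le_sum fun k _ => ?_)
          rw [← mul_sub, abs_mul, abs_neg]
          gcongr
          have := (hfl k).dist_le_mul x y
          rw [Real.dist_eq, dist_eq_norm, NNReal.coe_one, one_mul] at this
          rwa [sub_sub_sub_cancel_right]
      _ ≤ _ := by
          rw [← Finset.sum_mul]
          gcongr
          exact hPb _
  · refine ⟨∑ k, 10 / ε * C k, fun μ _ x v w => ?_⟩
    have hD : D2 (H (I μ)) x v w = ∑ k, (-P (a₀ - I μ) k) * D2 (f k) x v w := by
      have hdf : ∀ k, Differentiable ℝ (f k) := fun k => (hfc k).differentiable (by norm_num)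
      have h1 : ∀ y, fderiv ℝ (H (I μ)) y v = ∑ k, (-P (a₀ - I μ) k) * fderiv ℝ (f k) y v := by
        intro y
        have : HasFDerivAt (H (I μ)) (∑ k, (-P (a₀ - I μ) k) • fderiv ℝ (f k) y) y := by
          simp only [H]
          refine HasFDerivAt.fun_sum fun k _ => ?_
          exact (((hdf k) y).hasFDerivAt.sub_const _).const_mul _
        rw [this.fderiv]
        simp
      unfold D2
      simp only [h1]
      have hd : ∀ k, DifferentiableAt ℝ (fun y => fderiv ℝ (f k) y v) x := fun k =>
        (((hfc k).fderiv_right (m := 1) (by norm_num)).differentiable (by norm_num) x).clm_apply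
          (differentiableAt_const v)
      have : HasFDerivAt (fun y => ∑ k, (-P (a₀ - I μ) k) * fderiv ℝ (f k) y v)
          (∑ k, (-P (a₀ - I μ) k) • fderiv ℝ (fun y => fderiv ℝ (f k) y v) x) x :=
        HasFDerivAt.fun_sum fun k _ => (hd k).hasFDerivAt.const_mul _
      rw [this.fderiv]
      simp
    change |D2 (H (I μ)) x v w| ≤ _
    rw [hD, Finset.sum_mul, Finset.sum_mul]
    refine (Finset.abs_sum_le_sum_abs _ _).trans (Finset.sum_le_sum fun k _ => ?_)
    rw [abs_mul, abs_neg]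
    have h1 : |P (a₀ - I μ) k| ≤ 10 / ε :=
      (Finset.single_le_sum (f := fun k => |P (a₀ - I μ) k|) (fun _ _ => abs_nonneg _)
        (Finset.mem_univ k)).trans (hPb _)
    calc _ ≤ 10 / ε * (C k * ‖v‖ * ‖w‖) :=
          mul_le_mul h1 (hC k x v w) (abs_nonneg _) hK
      _ = _ := by ring
end
end

section
/- Let A and B be closed subsets of P(𝕋^d) with empty intersection. Then there exists a C¹ (in the flat-derivative sense) map Φ : P(𝕋^d) → ℝ such that Φ = 1 on A, Φ = 0 on B, and D_x D_mΦ is bounded. -/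
/- Common framework for "On the long time convergence of potential MFG" (M. Masoero).

We work on the flat torus `𝕋^d`, modeled as `Td d := Fin d → AddCircle 1`.
Smooth functions on the torus are represented by `ℤ^d`-periodic functions on
`Vd d := Fin d → ℝ`; a function on `Vd d` is transported to the torus through the
canonical (measurable) section `secT : Td d → Vd d`.  Probability measures on the
torus are `PTd d := ProbabilityMeasure (Td d)`, endowed with the 1-Wasserstein
distance `W1` defined through Kantorovich duality.  The Fokker--Planck equations
and their stationary analogues are stated in the sense of distributions, i.e.
against smooth periodic test functions; `σ` is the viscosity parameter
(everywhere `σ = 1` except in the non-convex example). -/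

open MeasureTheory Real Set Filter

noncomputable section

/-- The projection from `ℝ^d` to the torus. -/
def projT {d : ℕ} (x : Vd d) : Td d := fun i => (x i : AddCircle (1:ℝ))

lemma projT_secT {d : ℕ} (y : Td d) : projT (secT y) = y := by
  funext i
  exact (AddCircle.equivIco 1 0).symm_apply_apply (y i)

lemma projT_add_int {d : ℕ} (x : Vd d) (z : Fin d → ℤ) : projT (x + intVec z) = projT x := by
  funext i
  simp only [projT, intVec, Pi.add_apply, AddCircle.coe_add]
  have : ((z i : ℝ) : AddCircle (1:ℝ)) = 0 := by
    rw [AddCircle.coe_eq_zero_iff]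
    exact ⟨z i, by simp⟩
  rw [this, add_zero]

lemma continuous_projT {d : ℕ} : Continuous (projT (d := d)) := by
  refine continuous_pi fun i => ?_
  exact (AddCircle.continuous_mk' (1:ℝ)).comp (continuous_apply i)

lemma per_bdd {d : ℕ} {G : Type*} [NormedAddCommGroup G] (h : Vd d → G) (hc : Continuous h)
    (hp : ∀ (x : Vd d) (z : Fin d → ℤ), h (x + intVec z) = h x) :
    ∃ C : ℝ, 0 ≤ C ∧ ∀ x, ‖h x‖ ≤ C := by
  obtain ⟨C, hC⟩ := (isCompact_Icc (a := (0 : Vd d)) (b := 1)).exists_bound_of_continuousOn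
    hc.continuousOn
  refine ⟨C, (norm_nonneg _).trans (hC 0 ⟨le_rfl, zero_le_one⟩), fun x => ?_⟩
  have h1 : h x = h (fun i => Int.fract (x i)) := by
    rw [← hp (fun i => Int.fract (x i)) (fun i => ⌊x i⌋)]
    congr 1
    funext i
    simp [intVec]
  rw [h1]
  exact hC _ ⟨fun i => Int.fract_nonneg _, fun i => (Int.fract_lt_one _).le⟩

lemma fderiv_per {d : ℕ} {G : Type*} [NormedAddCommGroup G] [NormedSpace ℝ G] (h : Vd d → G)
    (hp : ∀ (x : Vd d) (z : Fin d → ℤ), h (x + intVec z) = h x) (x : Vd d) (z : Fin d → ℤ) :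
    fderiv ℝ h (x + intVec z) = fderiv ℝ h x := by
  rw [← fderiv_comp_add_right (intVec z)]
  congr 1
  funext y
  exact hp y z

lemma exists_lift {d : ℕ} (s : Td d) : ∃ x : Vd d, projT x = s ∧ ‖x‖ = ‖s‖ := by
  have : ∀ i, ∃ r : ℝ, (r : AddCircle (1:ℝ)) = s i ∧ ‖r‖ = ‖s i‖ := by
    intro i
    obtain ⟨r, hr⟩ := QuotientAddGroup.mk_surjective (s i)
    refine ⟨r - round r, ?_, ?_⟩
    · rw [AddCircle.coe_sub, ← hr]
      have : ((round r : ℝ) : AddCircle (1:ℝ)) = 0 := by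
        rw [AddCircle.coe_eq_zero_iff]
        exact ⟨round r, by simp⟩
      rw [this, sub_zero]
    · rw [← hr]
      exact (UnitAddCircle.norm_eq (x := r)).symm
  choose r hr hn using this
  refine ⟨r, funext hr, ?_⟩
  simp only [Pi.norm_def]
  congr 2
  funext i
  exact NNReal.eq (hn i)

lemma smooth_lip {d : ℕ} (f : C(Td d, ℝ)) (hf : ContDiff ℝ 2 (fun x => f (projT x))) :
    ∃ K : NNReal, LipschitzWith K f := by
  have hper : ∀ (x : Vd d) (z : Fin d → ℤ), f (projT (x + intVec z)) = f (projT x) :=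
    fun x z => by rw [projT_add_int]
  obtain ⟨C, hC0, hC⟩ := per_bdd (fderiv ℝ (fun x => f (projT x)))
    (hf.continuous_fderiv (by norm_num)) (fderiv_per _ hper)
  refine ⟨⟨C, hC0⟩, LipschitzWith.of_dist_le_mul fun s t => ?_⟩
  have hL : LipschitzWith ⟨C, hC0⟩ (fun x => f (projT x)) :=
    lipschitzWith_of_nnnorm_fderiv_le (hf.differentiable (by norm_num)) (fun x => hC x)
  obtain ⟨x, hx, -⟩ := exists_lift t
  obtain ⟨z, hz, hzn⟩ := exists_lift (s - t)
  have h1 : projT (z + x) = s := by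
    have : projT (z + x) = projT z + projT x := by
      funext i; simp [projT]
    rw [this, hx, hz]; simp
  have := hL.dist_le_mul (z + x) x
  simp only [h1, hx] at this
  rwa [dist_eq_norm (z + x), add_sub_cancel_right, hzn, ← dist_eq_norm] at this

lemma cont_int {d : ℕ} {f : Td d → ℝ} (hf : Continuous f) (μ : Measure (Td d)) [IsFiniteMeasure μ] :
    Integrable f μ :=
  (BoundedContinuousFunction.mkOfCompact ⟨f, hf⟩).integrable μ

lemma lip_int_le {d : ℕ} {φ : Td d → ℝ} (hφ : LipschitzWith 1 φ) (μ ν : PTd d) :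
    (∫ y, φ y ∂(μ : Measure (Td d))) - ∫ y, φ y ∂(ν : Measure (Td d)) ≤
      2 * Metric.diam (univ : Set (Td d)) := by
  have key : ∀ μ : PTd d, |(∫ y, φ y ∂(μ : Measure (Td d))) - φ 0| ≤
      Metric.diam (univ : Set (Td d)) := by
    intro μ
    have : (∫ y, φ y ∂(μ : Measure (Td d))) - φ 0 = ∫ y, (φ y - φ 0) ∂(μ : Measure (Td d)) := by
      rw [integral_sub (cont_int hφ.continuous _) (integrable_const _)]; simp
    rw [this]
    have := norm_integral_le_of_norm_le_const (μ := (μ : Measure (Td d)))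
      (f := fun y => φ y - φ 0) (C := Metric.diam (univ : Set (Td d))) ?_
    · simpa using this
    · refine Eventually.of_forall fun y => ?_
      rw [← dist_eq_norm]
      refine (hφ.dist_le_mul y 0).trans ?_
      simp only [NNReal.coe_one, one_mul]
      exact Metric.dist_le_diam_of_mem isCompact_univ.isBounded (mem_univ _) (mem_univ _)
  have h1 := abs_le.1 (key μ)
  have h2 := abs_le.1 (key ν)
  linarith

lemma le_W1 {d : ℕ} {φ : Td d → ℝ} (hφ : LipschitzWith 1 φ) (μ ν : PTd d) :
    (∫ y, φ y ∂(μ : Measure (Td d))) - ∫ y, φ y ∂(ν : Measure (Td d)) ≤ W1 μ ν := by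
  refine le_csSup ⟨2 * Metric.diam (univ : Set (Td d)), ?_⟩ ⟨φ, hφ, rfl⟩
  rintro r ⟨ψ, hψ, rfl⟩
  exact lip_int_le hψ μ ν

lemma abs_le_W1 {d : ℕ} {φ : Td d → ℝ} {K : NNReal} (hφ : LipschitzWith K φ) (μ ν : PTd d) :
    |(∫ y, φ y ∂(μ : Measure (Td d))) - ∫ y, φ y ∂(ν : Measure (Td d))| ≤ (K + 1) * W1 μ ν := by
  have hK : (0:ℝ) < K + 1 := by positivity
  have h1 : LipschitzWith 1 (fun y => (K + 1 : ℝ)⁻¹ * φ y) := by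
    refine LipschitzWith.of_dist_le_mul fun s t => ?_
    rw [Real.dist_eq, ← mul_sub, abs_mul, abs_of_pos (inv_pos.2 hK), inv_mul_le_iff₀ hK]
    have := hφ.dist_le_mul s t
    rw [Real.dist_eq] at this
    simp only [NNReal.coe_one, one_mul]
    nlinarith [dist_nonneg (x := s) (y := t)]
  have h2 : LipschitzWith 1 (fun y => -((K + 1 : ℝ)⁻¹ * φ y)) := h1.neg
  have a1 := le_W1 h1 μ ν
  have a2 := le_W1 h2 μ ν
  simp only [integral_neg, integral_const_mul] at a1 a2
  rw [abs_le]
  constructor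
  · have : (K + 1 : ℝ)⁻¹ * ((∫ y, φ y ∂(ν : Measure (Td d))) - ∫ y, φ y ∂(μ : Measure (Td d)))
        ≤ W1 μ ν := by linarith
    rw [inv_mul_le_iff₀ hK] at this
    linarith
  · have : (K + 1 : ℝ)⁻¹ * ((∫ y, φ y ∂(μ : Measure (Td d))) - ∫ y, φ y ∂(ν : Measure (Td d)))
        ≤ W1 μ ν := by linarith
    rwa [inv_mul_le_iff₀ hK] at this

lemma W1_weak {d : ℕ} (μ : PTd d) {ε : ℝ} (hε : 0 < ε) :
    ∀ᶠ ν in nhds μ, W1 μ ν < ε := by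
  let S : Set (BoundedContinuousFunction (Td d) ℝ) := {f | LipschitzWith 1 f ∧ f 0 = 0}
  have hS : IsCompact (closure S) := by
    refine BoundedContinuousFunction.arzela_ascoli
      (Metric.closedBall 0 (Metric.diam (univ : Set (Td d)))) (isCompact_closedBall _ _) S ?_ ?_
    · rintro f x ⟨hf, h0⟩
      rw [Metric.mem_closedBall, ← h0]
      refine (hf.dist_le_mul x 0).trans ?_
      simp only [NNReal.coe_one, one_mul]
      exact Metric.dist_le_diam_of_mem isCompact_univ.isBounded (mem_univ _) (mem_univ _)
    · exact (LipschitzWith.uniformEquicontinuous _ 1 (fun f => f.2.1)).equicontinuous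
  obtain ⟨t, ht, hcov⟩ := Metric.totallyBounded_iff.1 hS.totallyBounded (ε / 4) (by positivity)
  have hev : ∀ᶠ ν in nhds μ, ∀ f ∈ t,
      |(∫ y, f y ∂(μ : Measure (Td d))) - ∫ y, f y ∂((ν : PTd d) : Measure (Td d))| < ε / 4 := by
    rw [eventually_all_finite ht]
    intro f _
    have hc : Continuous fun ν : PTd d => ∫ y, f y ∂(ν : Measure (Td d)) :=
      ProbabilityMeasure.continuous_integral_boundedContinuousFunction f
    have hc2 : Continuous fun ν : PTd d => |(∫ y, f y ∂(μ : Measure (Td d))) -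
      ∫ y, f y ∂(ν : Measure (Td d))| := (continuous_const.sub hc).abs
    exact hc2.continuousAt.eventually_lt continuousAt_const (by simpa using by positivity)
  filter_upwards [hev] with ν hν
  have : W1 μ ν ≤ 3 * ε / 4 := by
    refine csSup_le ⟨_, fun _ => 0, LipschitzWith.const 0 |>.weaken zero_le_one, rfl⟩ ?_
    rintro r ⟨φ, hφ, rfl⟩
    let g : BoundedContinuousFunction (Td d) ℝ :=
      BoundedContinuousFunction.mkOfCompact ⟨fun y => φ y - φ 0, hφ.continuous.sub continuous_const⟩
    have hgS : g ∈ S := by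
      refine ⟨LipschitzWith.of_dist_le_mul fun s t => ?_, ?_⟩
      · have := hφ.dist_le_mul s t
        simpa [g] using this
      · simp [g]
    obtain ⟨f, hft, hgf⟩ := mem_iUnion₂.1 (hcov (subset_closure hgS))
    rw [Metric.mem_ball] at hgf
    have hd : ∀ m : PTd d, |(∫ y, φ y ∂(m : Measure (Td d))) - φ 0 -
        ∫ y, f y ∂(m : Measure (Td d))| ≤ ε / 4 := by
      intro m
      have e : (∫ y, φ y ∂(m : Measure (Td d))) - φ 0 - ∫ y, f y ∂(m : Measure (Td d)) =
          ∫ y, (g y - f y) ∂(m : Measure (Td d)) := by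
        rw [integral_sub (g.integrable _) (f.integrable _)]
        congr 1
        simp only [g, BoundedContinuousFunction.mkOfCompact_apply, ContinuousMap.coe_mk]
        rw [integral_sub (cont_int hφ.continuous _) (integrable_const _)]; simp
      rw [e]
      have := norm_integral_le_of_norm_le_const (μ := (m : Measure (Td d)))
        (f := fun y => g y - f y) (C := ε / 4) ?_
      · simpa using this
      · refine Eventually.of_forall fun y => ?_
        rw [← dist_eq_norm]
        exact (BoundedContinuousFunction.dist_coe_le_dist y).trans hgf.le
    have h1 := abs_le.1 (hd μ)
    have h2 := abs_le.1 (hd ν)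
    have h3 := abs_lt.1 (hν f hft)
    linarith
  linarith

lemma closed_of_W1 {d : ℕ} {A : Set (PTd d)} (hA : IsClosedW1 A) : IsClosed A := by
  refine isClosed_of_closure_subset fun μ hμ => hA μ fun ε hε => ?_
  obtain ⟨ν, h1, h2⟩ := mem_closure_iff_nhds.1 hμ _ (W1_weak μ hε)
  exact ⟨ν, h2, h1⟩

/-- Smooth functions on the torus. -/
def smoothAlg (d : ℕ) : Subalgebra ℝ C(Td d, ℝ) where
  carrier := {f | ContDiff ℝ 2 (fun x : Vd d => f (projT x))}
  mul_mem' := by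
    intro a b ha hb
    have ha : ContDiff ℝ 2 (fun x : Vd d => a (projT x)) := ha
    have hb : ContDiff ℝ 2 (fun x : Vd d => b (projT x)) := hb
    exact ha.mul hb
  add_mem' := by
    intro a b ha hb
    have ha : ContDiff ℝ 2 (fun x : Vd d => a (projT x)) := ha
    have hb : ContDiff ℝ 2 (fun x : Vd d => b (projT x)) := hb
    exact ha.add hb
  algebraMap_mem' := by
    intro r
    change ContDiff ℝ 2 (fun _ : Vd d => r)
    exact contDiff_const

lemma cosT (φ : ℝ → ℝ) (hφ : Function.Periodic φ 1) (hs : ContDiff ℝ 2 φ) {d : ℕ} (i : Fin d) :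
    ∃ f ∈ smoothAlg d, ∀ x : Vd d, f (projT x) = φ (x i) := by
  have hc : Continuous (hφ.lift) := continuous_coinduced_dom.2 hs.continuous
  refine ⟨⟨fun y => hφ.lift (y i), hc.comp (continuous_apply i)⟩, ?_, fun x => rfl⟩
  change ContDiff ℝ 2 (fun x : Vd d => φ (x i))
  exact hs.comp (contDiff_apply ℝ ℝ i)

lemma smooth_sep (d : ℕ) : (smoothAlg d).SeparatesPoints := by
  intro s t hst
  obtain ⟨i, hi⟩ := Function.ne_iff.1 hst
  obtain ⟨x, rfl, -⟩ := exists_lift s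
  obtain ⟨y, rfl, -⟩ := exists_lift t
  by_contra hcon
  push Not at hcon
  have key : ∀ f ∈ smoothAlg d, f (projT x) = f (projT y) := fun f hf =>
    hcon _ ⟨f, hf, rfl⟩
  obtain ⟨f, hf, hfx⟩ := cosT (fun r => Real.cos (2 * π * r)) (fun r => by
    simp only [mul_add, mul_one, Real.cos_add_two_pi]) (by fun_prop) i
  obtain ⟨g, hg, hgx⟩ := cosT (fun r => Real.sin (2 * π * r)) (fun r => by
    simp only [mul_add, mul_one, Real.sin_add_two_pi]) (by fun_prop) i
  have h1 := key f hf
  have h2 := key g hg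
  rw [hfx, hfx] at h1
  rw [hgx, hgx] at h2
  have h3 := Real.Angle.cos_sin_inj h1 h2
  rw [Real.Angle.angle_eq_iff_two_pi_dvd_sub] at h3
  obtain ⟨k, hk⟩ := h3
  apply hi
  simp only [projT]
  rw [← sub_eq_zero, ← AddCircle.coe_sub, AddCircle.coe_eq_zero_iff]
  refine ⟨k, ?_⟩
  have : 2 * π * (x i - y i) = 2 * π * k := by linarith
  have := mul_left_cancel₀ (by positivity) this
  simp [this]

lemma smooth_ext {d : ℕ} {μ ν : PTd d}
    (h : ∀ f ∈ smoothAlg d, ∫ y, f y ∂(μ : Measure (Td d)) = ∫ y, f y ∂(ν : Measure (Td d))) :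
    μ = ν := by
  have hd := ContinuousMap.subalgebra_topologicalClosure_eq_top_of_separatesPoints _ (smooth_sep d)
  have hcont : ∀ m : PTd d, Continuous fun f : C(Td d, ℝ) => ∫ y, f y ∂(m : Measure (Td d)) := by
    intro m
    refine (LipschitzWith.of_dist_le_mul (K := 1) fun f g => ?_).continuous
    rw [dist_eq_norm, ← integral_sub (cont_int f.continuous _) (cont_int g.continuous _)]
    have := norm_integral_le_of_norm_le_const (μ := (m : Measure (Td d)))
        (f := fun y => f y - g y) (C := dist f g) ?_
    · simpa using this
    · refine Eventually.of_forall fun y => ?_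
      rw [← dist_eq_norm]
      exact ContinuousMap.dist_apply_le_dist y
  have hall : ∀ f : C(Td d, ℝ), ∫ y, f y ∂(μ : Measure (Td d)) = ∫ y, f y ∂(ν : Measure (Td d)) := by
    intro f
    have hf : f ∈ closure (smoothAlg d : Set C(Td d, ℝ)) := by
      rw [← Subalgebra.topologicalClosure_coe, hd]; trivial
    have hcl := isClosed_eq (hcont μ) (hcont ν)
    exact closure_minimal (fun f hf => h f hf) hcl hf
  haveI : IsFiniteMeasure (μ : Measure (Td d)) := inferInstance
  apply Subtype.ext
  change (μ : Measure (Td d)) = (ν : Measure (Td d))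
  exact ext_of_forall_integral_eq_of_IsFiniteMeasure (fun f => hall f.toContinuousMap)

lemma finite_sep {d : ℕ} {A B : Set (PTd d)} (hA : IsClosed A) (hB : IsClosed B)
    (hAB : A ∩ B = ∅) : ∃ t : Finset (smoothAlg d), ∀ a ∈ A, ∀ b ∈ B, ∃ f ∈ t,
      ∫ y, f.1 y ∂(a : Measure (Td d)) ≠ ∫ y, f.1 y ∂(b : Measure (Td d)) := by
  have hc : ∀ f : C(Td d, ℝ), Continuous fun ν : PTd d => ∫ y, f y ∂(ν : Measure (Td d)) :=
    fun f => ProbabilityMeasure.continuous_integral_boundedContinuousFunction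
      (BoundedContinuousFunction.mkOfCompact f)
  letI : TopologicalSpace (PTd d × PTd d) := instTopologicalSpaceProd
  obtain ⟨t, ht⟩ := (hA.isCompact.prod hB.isCompact).elim_finite_subcover
    (fun f : smoothAlg d => {p : PTd d × PTd d |
      ∫ y, f.1 y ∂(p.1 : Measure (Td d)) ≠ ∫ y, f.1 y ∂(p.2 : Measure (Td d))})
    (fun f => isOpen_ne_fun ((hc f.1).comp continuous_fst) ((hc f.1).comp continuous_snd))
    (by
      rintro ⟨a, b⟩ ⟨ha, hb⟩
      by_contra hcon
      simp only [mem_iUnion, mem_ofPred_eq, not_exists, not_not] at hcon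
      have hab : a = b := smooth_ext fun f hf => hcon ⟨f, hf⟩
      have : a ∈ A ∩ B := ⟨ha, hab ▸ hb⟩
      rw [hAB] at this
      exact this)
  refine ⟨t, fun a ha b hb => ?_⟩
  have := ht (show (a, b) ∈ A ×ˢ B from ⟨ha, hb⟩)
  simpa using this

/-- Vector of moments. -/
def momT {d : ℕ} (t : Finset (smoothAlg d)) (μ : Measure (Td d)) : t → ℝ :=
  fun f => ∫ y, f.1.1 y ∂μ

/-- Vector of functions. -/
def evT {d : ℕ} (t : Finset (smoothAlg d)) (y : Td d) : t → ℝ := fun f => f.1.1 y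

lemma evT_cont {d : ℕ} (t : Finset (smoothAlg d)) : Continuous (evT t) :=
  continuous_pi fun f => f.1.1.continuous

lemma evT_contDiff {d : ℕ} (t : Finset (smoothAlg d)) : ContDiff ℝ 2 (fun x => evT t (projT x)) :=
  contDiff_pi.2 fun f => f.1.2

lemma evT_int {d : ℕ} (t : Finset (smoothAlg d)) (μ : Measure (Td d)) [IsFiniteMeasure μ] :
    Integrable (evT t) μ :=
  Integrable.of_eval fun f => cont_int f.1.1.continuous μ

lemma evT_integral {d : ℕ} (t : Finset (smoothAlg d)) (μ : Measure (Td d)) [IsFiniteMeasure μ] :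
    ∫ y, evT t y ∂μ = momT t μ := by
  funext f
  exact eval_integral (fun f => cont_int f.1.1.continuous μ) f

lemma momT_lineComb {d : ℕ} (t : Finset (smoothAlg d)) (μ ν : PTd d) {s : ℝ} (hs : s ∈ Icc (0:ℝ) 1) :
    momT t (lineComb s μ ν) = momT t μ + s • (momT t ν - momT t μ) := by
  funext f
  have h0 : 0 ≤ 1 - s := by linarith [hs.2]
  have hi : ∀ m : PTd d, Integrable (fun y => f.1.1 y) (m : Measure (Td d)) :=
    fun m => cont_int f.1.1.continuous _
  simp only [momT, lineComb, Pi.add_apply, Pi.smul_apply, Pi.sub_apply]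
  rw [integral_add_measure ((hi μ).smul_measure ENNReal.ofReal_ne_top)
    ((hi ν).smul_measure ENNReal.ofReal_ne_top), integral_smul_measure, integral_smul_measure,
    ENNReal.toReal_ofReal h0, ENNReal.toReal_ofReal hs.1]
  simp only [smul_eq_mul]
  ring

lemma momT_bdd {d : ℕ} (t : Finset (smoothAlg d)) : ∃ R : ℝ, ∀ μ : Measure (Td d),
    IsProbabilityMeasure μ → ‖momT t μ‖ ≤ R := by
  obtain ⟨R, hR⟩ := (isCompact_univ (X := Td d)).exists_bound_of_continuousOn
    (evT_cont t).continuousOn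
  refine ⟨R, fun μ hμ => ?_⟩
  rw [← evT_integral]
  have := norm_integral_le_of_norm_le_const (μ := μ) (f := evT t) (C := R)
    (Eventually.of_forall fun y => hR y (mem_univ _))
  simpa using this

lemma momT_W1 {d : ℕ} (t : Finset (smoothAlg d)) : ∃ K : ℝ, 0 < K ∧ ∀ μ ν : PTd d,
    ‖momT t (ν : Measure (Td d)) - momT t (μ : Measure (Td d))‖ ≤ K * W1 μ ν := by
  have : ∀ f : t, ∃ K : NNReal, LipschitzWith K f.1.1 := fun f => smooth_lip f.1.1 f.1.2
  choose K hK using this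
  refine ⟨∑ f, (K f + 1 : ℝ) + 1, by positivity, fun μ ν => ?_⟩
  have h0 : 0 ≤ W1 μ ν := by
    have := le_W1 (φ := fun _ => 0) (LipschitzWith.const 0 |>.weaken zero_le_one) μ ν
    simpa using this
  rw [pi_norm_le_iff_of_nonneg (by positivity)]
  intro f
  rw [Pi.sub_apply, norm_sub_rev]
  refine (abs_le_W1 (hK f) μ ν).trans ?_
  gcongr
  have := Finset.single_le_sum (f := fun f => (K f + 1 : ℝ)) (fun i _ => by positivity)
    (Finset.mem_univ f)
  linarith

/-- Lemma 4.3 of the paper.  For any two disjoint closed subsets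
`A, B` of `P(𝕋^d)` there is a `C¹` map `Φ` on `P(𝕋^d)` (with flat derivative `dΦ`) such
that `Φ = 1` on `A`, `Φ = 0` on `B`, and `D_x D_mΦ` is bounded. -/
theorem flat_separation_exists (d : ℕ) (A B : Set (PTd d))
    (hA : IsClosedW1 A) (hB : IsClosedW1 B) (hAB : A ∩ B = ∅) :
    ∃ (Φ : PTd d → ℝ) (dΦ : Measure (Td d) → Vd d → ℝ),
      IsC1Flat Φ dΦ ∧
      (∀ μ : Measure (Td d), IsProbabilityMeasure μ → ContDiff ℝ 2 (dΦ μ)) ∧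
      (∀ μ ∈ A, Φ μ = 1) ∧
      (∀ μ ∈ B, Φ μ = 0) ∧
      (∃ C : ℝ, ∀ μ : Measure (Td d), IsProbabilityMeasure μ →
        ∀ x v w : Vd d, |D2 (dΦ μ) x v w| ≤ C * ‖v‖ * ‖w‖) := by
  have hA' := closed_of_W1 hA
  have hB' := closed_of_W1 hB
  obtain ⟨t, ht⟩ := finite_sep hA' hB' hAB
  have hmc : Continuous fun μ : PTd d => momT t (μ : Measure (Td d)) :=
    continuous_pi fun f => ProbabilityMeasure.continuous_integral_boundedContinuousFunction
      (BoundedContinuousFunction.mkOfCompact f.1.1)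
  have hcA := (hA'.isCompact.image hmc).isClosed
  have hcB := (hB'.isCompact.image hmc).isClosed
  obtain ⟨g, hg, -, hg0, hg1⟩ := exists_contMDiff_zero_iff_one_iff_of_isClosed
    (n := (2 : ℕ∞)) (modelWithCornersSelf ℝ (t → ℝ)) hcB hcA (by
      rw [Set.disjoint_left]
      rintro _ ⟨b, hb, rfl⟩ ⟨a, ha, hab⟩
      obtain ⟨f, hf, hne⟩ := ht a ha b hb
      exact hne (congrFun hab ⟨f, hf⟩))
  have hg : ContDiff ℝ 2 g := hg.contDiff
  have hg' : Continuous (fderiv ℝ g) := hg.continuous_fderiv (by norm_num)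
  have hgd : Differentiable ℝ g := hg.differentiable (by norm_num)
  have hint : ∀ m ν : PTd d, ∀ L : (t → ℝ) →L[ℝ] ℝ, ∀ c : t → ℝ,
      ∫ y, L (evT t (projT (secT y)) - c) ∂(ν : Measure (Td d)) =
        L (momT t (ν : Measure (Td d)) - c) := by
    intro m ν L c
    simp only [projT_secT]
    have : Integrable (fun y => evT t y - c) (ν : Measure (Td d)) :=
      (evT_int t _).sub (integrable_const _)
    rw [L.integral_comp_comm this, integral_sub (evT_int t _) (integrable_const _), evT_integral]
    simp
  refine ⟨fun μ => g (momT t μ), fun μ x => fderiv ℝ g (momT t μ) (evT t (projT x) - momT t μ),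
    ⟨?_, ?_, ?_, ?_⟩, ?_, ?_, ?_, ?_⟩
  · intro μ x z
    beta_reduce
    rw [projT_add_int]
  · intro μ ν
    have e : ∀ s ∈ Icc (0:ℝ) 1,
        ((∫ y, fderiv ℝ g (momT t (lineComb s μ ν)) (evT t (projT (secT y)) -
            momT t (lineComb s μ ν)) ∂(ν : Measure (Td d))) -
          ∫ y, fderiv ℝ g (momT t (lineComb s μ ν)) (evT t (projT (secT y)) -
            momT t (lineComb s μ ν)) ∂(μ : Measure (Td d))) =
        fderiv ℝ g (momT t μ + s • (momT t (ν : Measure (Td d)) - momT t μ))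
          (momT t (ν : Measure (Td d)) - momT t μ) := by
      intro s hs
      rw [hint μ ν, hint μ μ, ← map_sub, ← momT_lineComb t μ ν hs]
      congr 1
      abel
    rw [setIntegral_congr_fun measurableSet_Icc e, integral_Icc_eq_integral_Ioc,
      ← intervalIntegral.integral_of_le zero_le_one]
    set a := momT t (μ : Measure (Td d))
    set b := momT t (ν : Measure (Td d)) - a with hb
    have hder : ∀ s : ℝ, HasDerivAt (fun s : ℝ => g (a + s • b)) (fderiv ℝ g (a + s • b) b) s := by
      intro s
      have h1 : HasDerivAt (fun s : ℝ => a + s • b) b s := by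
        simpa using ((hasDerivAt_id s).smul_const b).const_add a
      exact (hgd _).hasFDerivAt.comp_hasDerivAt s h1
    have hcont : Continuous fun s : ℝ => fderiv ℝ g (a + s • b) b :=
      (hg'.comp (by fun_prop)).clm_apply continuous_const
    rw [intervalIntegral.integral_eq_sub_of_hasDerivAt (fun s _ => hder s)
      (hcont.intervalIntegrable _ _)]
    simp [hb, a]
  · intro μ
    rw [hint μ μ]
    simp
  · intro ε hε μ x
    have hG : Continuous fun p : (t → ℝ) × Vd d => fderiv ℝ g p.1 (evT t (projT p.2) - p.1) :=
      (hg'.comp continuous_fst).clm_apply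
        (((evT_contDiff t).continuous.comp continuous_snd).sub continuous_fst)
    obtain ⟨δ, hδ, hδ'⟩ := Metric.continuousAt_iff.1
      (hG.continuousAt (x := (momT t (μ : Measure (Td d)), x))) ε hε
    obtain ⟨K, hK, hKW⟩ := momT_W1 t
    refine ⟨min (δ / K) δ, by positivity, fun ν x' hW hx => ?_⟩
    have := @hδ' (momT t (ν : Measure (Td d)), x') (by
      rw [Prod.dist_eq, max_lt_iff, dist_eq_norm, dist_eq_norm]
      refine ⟨(hKW μ ν).trans_lt ?_, hx.trans_le (min_le_right _ _)⟩
      have := hW.trans_le (min_le_left _ _)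
      rw [lt_div_iff₀ hK] at this
      linarith)
    rwa [Real.dist_eq] at this
  · intro μ _
    exact (fderiv ℝ g (momT t μ)).contDiff.comp ((evT_contDiff t).sub contDiff_const)
  · intro μ hμ
    exact (hg1 _).1 ⟨μ, hμ, rfl⟩
  · intro μ hμ
    exact (hg0 _).1 ⟨μ, hμ, rfl⟩
  · obtain ⟨R, hR⟩ := momT_bdd t
    obtain ⟨C1, hC1⟩ := (isCompact_closedBall (0 : t → ℝ) R).exists_bound_of_continuousOn
      hg'.continuousOn
    have hE := evT_contDiff t
    have hE1 : ContDiff ℝ 1 (fderiv ℝ fun x => evT t (projT x)) := hE.fderiv_right (by norm_num)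
    obtain ⟨C2, hC20, hC2⟩ := per_bdd (fderiv ℝ (fderiv ℝ fun x => evT t (projT x)))
      (hE1.continuous_fderiv (by norm_num))
      (fderiv_per _ (fderiv_per _ (fun x z => by rw [projT_add_int])))
    refine ⟨C1 * C2, fun μ hμ x v w => ?_⟩
    set L := fderiv ℝ g (momT t μ) with hL
    have hLn : ‖L‖ ≤ C1 := hC1 _ (by simpa using hR μ hμ)
    have e1 : (fun y => fderiv ℝ (fun x => L (evT t (projT x) - momT t μ)) y v) =
        fun y => L (fderiv ℝ (fun x => evT t (projT x)) y v) := by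
      funext y
      have h1 : HasFDerivAt (fun x => evT t (projT x) - momT t μ)
          (fderiv ℝ (fun x => evT t (projT x)) y) y :=
        ((hE.differentiable (by norm_num)) y).hasFDerivAt.sub_const _
      have h2 : HasFDerivAt (fun x => L (evT t (projT x) - momT t μ)) _ y :=
        L.hasFDerivAt.comp y h1
      rw [h2.fderiv]
      rfl
    have e2 : D2 (fun x => L (evT t (projT x) - momT t μ)) x v w =
        L (fderiv ℝ (fderiv ℝ fun x => evT t (projT x)) x w v) := by
      unfold D2
      rw [e1]
      have h2 := ((hE1.differentiable (by norm_num)) x).hasFDerivAt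
      have h3 := h2.clm_apply (hasFDerivAt_const v x)
      have h4 : HasFDerivAt (fun y => L (fderiv ℝ (fun x => evT t (projT x)) y v)) _ x :=
        L.hasFDerivAt.comp x h3
      rw [h4.fderiv]
      simp
    rw [e2, ← Real.norm_eq_abs]
    have hC10 : 0 ≤ C1 := (norm_nonneg _).trans hLn
    calc _ ≤ ‖L‖ * ‖fderiv ℝ (fderiv ℝ fun x => evT t (projT x)) x w v‖ := L.le_opNorm _
      _ ≤ C1 * (C2 * ‖w‖ * ‖v‖) := by
        gcongr
        refine (ContinuousLinearMap.le_opNorm₂ _ _ _).trans ?_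
        gcongr
        exact hC2 x
      _ = C1 * C2 * ‖v‖ * ‖w‖ := by ring
end
end
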